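/- Let b ∈ BMO(ℝⁿ) with b⁻ ∈ L^∞(ℝⁿ). Then there is a constant C such that for every cube Q ⊂ ℝⁿ, (1/|Q|)∫_Q |b(y) − M_Q(b)(y)| dy ≤ C(‖b‖_* + ‖b⁻‖_∞). -/

import Mathlib

open MeasureTheory Real

noncomputable section

/-- A (closed) cube in ℝⁿ. -/
def IsCube {n : ℕ} (Q : Set (Fin n → ℝ)) : Prop :=
  ∃ (c : Fin n → ℝ) (r : ℝ), 0 < r ∧ Q = {y | ∀ i, |y i - c i| ≤ r}

/-- Lebesgue measure of a set, as a real number. -/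
def vol {n : ℕ} (Q : Set (Fin n → ℝ)) : ℝ := (volume Q).toReal

/-- Average of `b` over `Q`. -/
def avg {n : ℕ} (b : (Fin n → ℝ) → ℝ) (Q : Set (Fin n → ℝ)) : ℝ :=
  (vol Q)⁻¹ * ∫ y in Q, b y

/-- Fractional maximal function `M_α`. -/
def fracMax {n : ℕ} (α : ℝ) (f : (Fin n → ℝ) → ℝ) (x : Fin n → ℝ) : ℝ :=
  sSup {v : ℝ | ∃ Q : Set (Fin n → ℝ), IsCube Q ∧ x ∈ Q ∧
    v = (vol Q) ^ (α / n - 1) * ∫ y in Q, |f y|}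

/-- Local fractional maximal function `M_{α,Q*}` restricted to subcubes of `Qs`. -/
def fracMaxLoc {n : ℕ} (α : ℝ) (Qs : Set (Fin n → ℝ)) (f : (Fin n → ℝ) → ℝ)
    (x : Fin n → ℝ) : ℝ :=
  sSup {v : ℝ | ∃ Q : Set (Fin n → ℝ), IsCube Q ∧ x ∈ Q ∧ Q ⊆ Qs ∧
    v = (vol Q) ^ (α / n - 1) * ∫ y in Q, |f y|}

/-- Hardy–Littlewood maximal function over cubes. -/
def HLmax {n : ℕ} (f : (Fin n → ℝ) → ℝ) (x : Fin n → ℝ) : ℝ := fracMax 0 f x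

/-- Fefferman–Stein sharp maximal function. -/
def sharpMax {n : ℕ} (f : (Fin n → ℝ) → ℝ) (x : Fin n → ℝ) : ℝ :=
  sSup {v : ℝ | ∃ Q : Set (Fin n → ℝ), IsCube Q ∧ x ∈ Q ∧
    v = (vol Q)⁻¹ * ∫ y in Q, |f y - avg f Q|}

/-- Maximal commutator `M_{α,b}`. -/
def fracMaxComm {n : ℕ} (α : ℝ) (b f : (Fin n → ℝ) → ℝ) (x : Fin n → ℝ) : ℝ :=
  sSup {v : ℝ | ∃ Q : Set (Fin n → ℝ), IsCube Q ∧ x ∈ Q ∧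
    v = (vol Q) ^ (α / n - 1) * ∫ y in Q, |b x - b y| * |f y|}

/-- Nonlinear commutator `[b, M_α]`. -/
def commFM {n : ℕ} (α : ℝ) (b f : (Fin n → ℝ) → ℝ) (x : Fin n → ℝ) : ℝ :=
  b x * fracMax α f x - fracMax α (fun y => b y * f y) x

/-- Nonlinear commutator `[b, M♯]`. -/
def commSharp {n : ℕ} (b f : (Fin n → ℝ) → ℝ) (x : Fin n → ℝ) : ℝ :=
  b x * sharpMax f x - sharpMax (fun y => b y * f y) x

/-- Cube centered at `x` of side length `t`. -/
def sliceCube {n : ℕ} (x : Fin n → ℝ) (t : ℝ) : Set (Fin n → ℝ) :=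
  {y | ∀ i, |y i - x i| ≤ t / 2}

/-- Slice space norm `‖f‖_{(E_r^p)_t}` (inner exponent `r`, outer exponent `p`). -/
def sliceNorm {n : ℕ} (r p t : ℝ) (f : (Fin n → ℝ) → ℝ) : ℝ :=
  (∫ x : Fin n → ℝ,
    ((vol (sliceCube x t))⁻¹ * ∫ y in sliceCube x t, |f y| ^ r) ^ (p / r)) ^ (1 / p)

/-- Membership in the slice space `(E_r^p)_t`. -/
def MemSlice {n : ℕ} (r p t : ℝ) (f : (Fin n → ℝ) → ℝ) : Prop :=
  AEStronglyMeasurable f volume ∧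
  Integrable (fun x : Fin n → ℝ =>
    ((vol (sliceCube x t))⁻¹ * ∫ y in sliceCube x t, |f y| ^ r) ^ (p / r))

/-- The BMO seminorm `‖b‖_*`. -/
def bmoNorm {n : ℕ} (b : (Fin n → ℝ) → ℝ) : ℝ :=
  sSup {v : ℝ | ∃ Q : Set (Fin n → ℝ), IsCube Q ∧
    v = (vol Q)⁻¹ * ∫ y in Q, |b y - avg b Q|}

/-- `b ∈ BMO(ℝⁿ)`. -/
def MemBMO {n : ℕ} (b : (Fin n → ℝ) → ℝ) : Prop :=
  ∃ C : ℝ, ∀ Q : Set (Fin n → ℝ), IsCube Q →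
    (vol Q)⁻¹ * ∫ y in Q, |b y - avg b Q| ≤ C

/-- Negative part `b⁻`. -/
def bneg {n : ℕ} (b : (Fin n → ℝ) → ℝ) (x : Fin n → ℝ) : ℝ := max (-(b x)) 0

/-- `b⁻ ∈ L^∞`. -/
def NegPartBounded {n : ℕ} (b : (Fin n → ℝ) → ℝ) : Prop :=
  ∃ C : ℝ, ∀ᵐ x : Fin n → ℝ, bneg b x ≤ C

/-- Essential sup norm of `b⁻`. -/
def negNorm {n : ℕ} (b : (Fin n → ℝ) → ℝ) : ℝ := essSup (fun x => bneg b x) volume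

/-- "`M_α f x < ∞`": the defining set of the supremum is bounded above. -/
def FracMaxFinite {n : ℕ} (α : ℝ) (f : (Fin n → ℝ) → ℝ) (x : Fin n → ℝ) : Prop :=
  BddAbove {v : ℝ | ∃ Q : Set (Fin n → ℝ), IsCube Q ∧ x ∈ Q ∧
    v = (vol Q) ^ (α / n - 1) * ∫ y in Q, |f y|}

open Metric in
/-- Points of a cube lying in a subcube where the mean oscillation about the big average is large. -/
def badSet {n : ℕ} (b : (Fin n → ℝ) → ℝ) (c : Fin n → ℝ) (R L : ℝ) : Set (Fin n → ℝ) :=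
  {x | ∃ w r, 0 < r ∧ x ∈ closedBall w r ∧ closedBall w r ⊆ closedBall c R ∧
    L * vol (closedBall w r) < ∫ y in closedBall w r, |b y - avg b (closedBall c R)|}

lemma vol_ball {n : ℕ} (c : Fin n → ℝ) {r : ℝ} (hr : 0 < r) :
    vol (Metric.closedBall c r) = (2 * r) ^ n := by
  unfold vol
  rw [Real.volume_pi_closedBall c hr.le, ENNReal.toReal_ofReal (by positivity), Fintype.card_fin]

lemma volume_cball {n : ℕ} (c : Fin n → ℝ) (r : ℝ) :
    volume (Metric.closedBall c r) = ENNReal.ofReal (vol (Metric.closedBall c r)) := by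
  unfold vol
  rw [ENNReal.ofReal_toReal]
  exact (isCompact_closedBall c r).measure_lt_top.ne

lemma cube_iff {n : ℕ} (Q : Set (Fin n → ℝ)) :
    IsCube Q ↔ ∃ c r, 0 < r ∧ Q = Metric.closedBall c r := by
  unfold IsCube
  have : ∀ (c : Fin n → ℝ) (r : ℝ), 0 < r →
      Metric.closedBall c r = {y | ∀ i, |y i - c i| ≤ r} := by
    intro c r hr
    ext y
    simp only [Metric.mem_closedBall, Set.mem_ofPred_eq]
    rw [dist_pi_le_iff hr.le]
    simp [Real.dist_eq]
  constructor
  · rintro ⟨c, r, hr, h⟩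
    exact ⟨c, r, hr, by rw [this c r hr, h]⟩
  · rintro ⟨c, r, hr, h⟩
    exact ⟨c, r, hr, by rw [← this c r hr, h]⟩

lemma intOn_osc {n : ℕ} {b : (Fin n → ℝ) → ℝ} (hb : LocallyIntegrable b volume) (m : ℝ)
    (w : Fin n → ℝ) (r : ℝ) : IntegrableOn (fun y => |b y - m|) (Metric.closedBall w r) := by
  have h1 : IntegrableOn b (Metric.closedBall w r) :=
    hb.integrableOn_isCompact (isCompact_closedBall w r)
  have h2 : IntegrableOn (fun _ : Fin n → ℝ => m) (Metric.closedBall w r) :=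
    integrableOn_const (isCompact_closedBall w r).measure_lt_top.ne
  exact (h1.sub h2).abs

lemma avg_sub_le {n : ℕ} {b : (Fin n → ℝ) → ℝ} (hb : LocallyIntegrable b volume) (m : ℝ)
    (w : Fin n → ℝ) {r : ℝ} (hr : 0 < r) :
    |avg b (Metric.closedBall w r) - m| * vol (Metric.closedBall w r) ≤
      ∫ y in Metric.closedBall w r, |b y - m| := by
  have hv : 0 < vol (Metric.closedBall w r) := by rw [vol_ball w hr]; positivity
  have h1 : IntegrableOn b (Metric.closedBall w r) :=
    hb.integrableOn_isCompact (isCompact_closedBall w r)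
  have h2 : IntegrableOn (fun _ : Fin n → ℝ => m) (Metric.closedBall w r) :=
    integrableOn_const (isCompact_closedBall w r).measure_lt_top.ne
  have h3 : ∫ y in Metric.closedBall w r, (b y - m) =
      (avg b (Metric.closedBall w r) - m) * vol (Metric.closedBall w r) := by
    rw [integral_sub h1 h2, setIntegral_const, measureReal_def]
    change _ - vol _ • m = _
    unfold avg
    rw [smul_eq_mul]
    field_simp
  calc _ = |(avg b (Metric.closedBall w r) - m) * vol (Metric.closedBall w r)| := by
        rw [abs_mul, abs_of_pos hv]
    _ ≤ _ := by
        rw [← h3]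
        exact abs_integral_le_integral_abs

lemma exists_clamp {n : ℕ} (c w : Fin n → ℝ) {R s : ℝ} (hs : 0 < s) (hsR : s < R)
    : ∃ w', Metric.closedBall w' s ⊆ Metric.closedBall c R ∧
      Metric.closedBall w s ∩ Metric.closedBall c R ⊆ Metric.closedBall w' s := by
  refine ⟨fun i => max (c i - (R - s)) (min (c i + (R - s)) (w i)), ?_, ?_⟩
  · intro y hy
    rw [Metric.mem_closedBall, dist_pi_le_iff (by linarith)] at hy ⊢
    intro i
    have := hy i
    rw [Real.dist_eq, abs_le] at this ⊢
    rcases max_cases (c i - (R - s)) (min (c i + (R - s)) (w i)) with h | h <;>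
    rcases min_cases (c i + (R - s)) (w i) with h' | h' <;>
    constructor <;> linarith
  · rintro y ⟨hy, hy2⟩
    rw [Metric.mem_closedBall, dist_pi_le_iff (by linarith)] at hy hy2 ⊢
    intro i
    have := hy i
    have h2 := hy2 i
    rw [Real.dist_eq, abs_le] at this h2 ⊢
    rcases max_cases (c i - (R - s)) (min (c i + (R - s)) (w i)) with h | h <;>
    rcases min_cases (c i + (R - s)) (w i) with h' | h' <;>
    constructor <;> linarith

open Metric in
lemma bad_step {n : ℕ} {b : (Fin n → ℝ) → ℝ} (hb : LocallyIntegrable b volume) {A : ℝ}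
    (hA : 0 < A)
    (hosc : ∀ c R, 0 < R → ∫ y in closedBall c R, |b y - avg b (closedBall c R)| ≤
      A * vol (closedBall c R))
    (L : ℝ) (hL : 0 ≤ L) (m : ENNReal)
    (ih : ∀ c R, 0 < R → m * volume (badSet b c R L) ≤ volume (closedBall c R))
    (c : Fin n → ℝ) (R : ℝ) (hR : 0 < R) :
    2 * m * volume (badSet b c R (L + 2 * 5 ^ n * A)) ≤ volume (closedBall c R) := by
  set M := avg b (closedBall c R) with hM
  set f : (Fin n → ℝ) → ℝ := fun y => |b y - M| with hf
  have hf0 : ∀ y, 0 ≤ f y := fun y => abs_nonneg _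
  set K : ℝ := 2 * 5 ^ n * A with hK
  have hKpos : 0 < K := by positivity
  have hfi : ∀ w r, IntegrableOn f (closedBall w r) := fun w r => intOn_osc hb M w r
  let good : (Fin n → ℝ) × ℝ → Prop := fun p => 0 < p.2 ∧ closedBall p.1 p.2 ⊆ closedBall c R ∧
    K * vol (closedBall p.1 p.2) < ∫ y in closedBall p.1 p.2, f y
  have small : ∀ p, good p → 5 * p.2 < R := by
    rintro ⟨w, r⟩ ⟨h0, hsub, hgt⟩
    simp only at h0 hsub hgt ⊢
    have h1 : ∫ y in closedBall w r, f y ≤ ∫ y in closedBall c R, f y :=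
      setIntegral_mono_set (hfi c R) (Filter.Eventually.of_forall hf0) hsub.eventuallyLE
    have h2 := hosc c R hR
    have h3 : K * vol (closedBall w r) < A * vol (closedBall c R) := by
      refine hgt.trans_le (h1.trans h2)
    rw [vol_ball w h0, vol_ball c hR] at h3
    have h4 : (2 * (5 * r)) ^ n < (2 * R) ^ n := by
      have e : K * (2 * r) ^ n = A * (2 * (2 * (5 * r)) ^ n) := by
        rw [hK, show 2 * (5 * r) = 5 * (2 * r) by ring, mul_pow 5]; ring
      rw [e] at h3
      have h5 := lt_of_mul_lt_mul_left h3 hA.le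
      have : 0 < (2 * (5 * r)) ^ n := by positivity
      linarith
    have := lt_of_pow_lt_pow_left₀ n (by positivity) h4
    linarith
  let t : Set ((Fin n → ℝ) × ℝ) := {p | good p ∧ ∀ q : (Fin n → ℝ) × ℝ, good q →
    closedBall p.1 p.2 ⊆ closedBall q.1 q.2 → q.2 < 2 * p.2}
  have claim : ∀ S, good S → ∃ p ∈ t, closedBall S.1 S.2 ⊆ closedBall p.1 p.2 := by
    intro S hS
    let T : Set ℝ := {r | ∃ q, good q ∧ closedBall S.1 S.2 ⊆ closedBall q.1 q.2 ∧ r = q.2}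
    have hST : S.2 ∈ T := ⟨S, hS, subset_rfl, rfl⟩
    have hbdd : BddAbove T := by
      refine ⟨R, ?_⟩
      rintro r ⟨q, hq, -, rfl⟩
      have := small q hq
      have := hq.1
      linarith
    have hpos : 0 < sSup T := hS.1.trans_le (le_csSup hbdd hST)
    obtain ⟨r, ⟨p, hp, hSp, rfl⟩, hlt⟩ := exists_lt_of_lt_csSup ⟨_, hST⟩ (half_lt_self hpos)
    refine ⟨p, ⟨hp, fun q hq hpq => ?_⟩, hSp⟩
    have := le_csSup hbdd (show q.2 ∈ T from ⟨q, hq, hSp.trans hpq, rfl⟩)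
    linarith
  obtain ⟨u, hut, hdisj, hcov⟩ := Vitali.exists_disjoint_subfamily_covering_enlargement_closedBall
    t (fun p => p.1) (fun p => p.2) R
    (fun p hp => by have := small p hp.1; have := hp.1.1; linarith) 5 (by norm_num)
  have hucount : u.Countable := by
    refine hdisj.countable_of_nonempty_interior fun p hp => ⟨p.1, ?_⟩
    exact ball_subset_interior_closedBall (mem_ball_self (hut hp).1.1)
  have hstar : ∀ p : (Fin n → ℝ) × ℝ, ∃ w', p ∈ t → closedBall w' (5 * p.2) ⊆ closedBall c R ∧
      closedBall p.1 (5 * p.2) ∩ closedBall c R ⊆ closedBall w' (5 * p.2) := by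
    intro p
    by_cases hp : p ∈ t
    · obtain ⟨w', h⟩ := exists_clamp c p.1 (s := 5 * p.2) (by have := hp.1.1; linarith)
        (small p hp.1)
      exact ⟨w', fun _ => h⟩
    · exact ⟨0, fun h => absurd h hp⟩
  choose W hW using hstar
  have hcover : badSet b c R (L + K) ⊆ ⋃ p ∈ u, badSet b (W p) (5 * p.2) L := by
    rintro x ⟨w, r, hr, hx, hsub, hgt⟩
    have hv : 0 < vol (closedBall w r) := by rw [vol_ball w hr]; positivity
    have hgood : good (w, r) := by
      refine ⟨hr, hsub, lt_of_le_of_lt ?_ hgt⟩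
      exact mul_le_mul_of_nonneg_right (by linarith) hv.le
    obtain ⟨p, hp, hSp⟩ := claim _ hgood
    obtain ⟨q, hq, hpq⟩ := hcov p hp
    have hqt := hut hq
    have hq0 : 0 < 5 * q.2 := by have := hqt.1.1; linarith
    have hsubW : closedBall w r ⊆ closedBall (W q) (5 * q.2) := fun y hy =>
      (hW q hqt).2 ⟨hpq (hSp hy), hsub hy⟩
    refine Set.mem_biUnion hq ⟨w, r, hr, hx, hsubW, ?_⟩
    -- the enlarged cube is not good
    have hng : ¬ good (W q, 5 * q.2) := by
      intro hg
      have h1 : closedBall q.1 q.2 ⊆ closedBall (W q) (5 * q.2) := fun y hy =>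
        (hW q hqt).2 ⟨closedBall_subset_closedBall (by linarith [hqt.1.1]) hy, hqt.1.2.1 hy⟩
      have := hqt.2 _ hg h1
      simp only at this
      linarith [hqt.1.1]
    have hle : ∫ y in closedBall (W q) (5 * q.2), f y ≤ K * vol (closedBall (W q) (5 * q.2)) := by
      by_contra hcon
      exact hng ⟨hq0, (hW q hqt).1, not_le.mp hcon⟩
    have hav := (avg_sub_le hb M (W q) hq0).trans hle
    have hvW : 0 < vol (closedBall (W q) (5 * q.2)) := by rw [vol_ball _ hq0]; positivity
    have hav' : |avg b (closedBall (W q) (5 * q.2)) - M| ≤ K := le_of_mul_le_mul_right hav hvW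
    set M' := avg b (closedBall (W q) (5 * q.2))
    have hint : ∫ y in closedBall w r, f y ≤ (∫ y in closedBall w r, |b y - M'|) +
        K * vol (closedBall w r) := by
      have hc : IntegrableOn (fun _ : Fin n → ℝ => K) (closedBall w r) :=
        integrableOn_const (isCompact_closedBall w r).measure_lt_top.ne
      have : ∫ y in closedBall w r, (|b y - M'| + K) = (∫ y in closedBall w r, |b y - M'|) +
        K * vol (closedBall w r) := by
        rw [integral_add (intOn_osc hb M' w r) hc, setIntegral_const, measureReal_def, smul_eq_mul,
          mul_comm K]
        rfl
      rw [← this]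
      refine integral_mono (hfi w r) ((intOn_osc hb M' w r).add hc) fun y => ?_
      have := abs_sub_le (b y) M' M
      simp only [hf]
      linarith
    have hgt' : (L + K) * vol (closedBall w r) < ∫ y in closedBall w r, f y := hgt
    linarith
  -- measure estimates
  have hsum : 2 * ∑' p : u, (5 : ENNReal) ^ n * volume (closedBall p.1.1 p.1.2) ≤
      volume (closedBall c R) := by
    have hA0 : ENNReal.ofReal A ≠ 0 := by simpa using hA
    rw [← ENNReal.mul_le_mul_iff_right hA0 ENNReal.ofReal_ne_top]
    have hKof : ENNReal.ofReal K = ENNReal.ofReal A * (2 * 5 ^ n) := by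
      rw [hK, mul_comm, ENNReal.ofReal_mul hA.le]
      congr 1
      rw [ENNReal.ofReal_mul (by norm_num), ENNReal.ofReal_pow (by norm_num)]
      norm_num
    have : ENNReal.ofReal A * (2 * ∑' p : u, (5 : ENNReal) ^ n * volume (closedBall p.1.1 p.1.2)) =
        ∑' p : u, ENNReal.ofReal K * volume (closedBall p.1.1 p.1.2) := by
      rw [ENNReal.tsum_mul_left, ENNReal.tsum_mul_left, hKof]
      ring
    rw [this]
    calc ∑' p : u, ENNReal.ofReal K * volume (closedBall p.1.1 p.1.2)
        ≤ ∑' p : u, ∫⁻ y in closedBall p.1.1 p.1.2, ENNReal.ofReal (f y) := by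
          refine ENNReal.tsum_le_tsum fun p => ?_
          rw [← ofReal_integral_eq_lintegral_ofReal (hfi _ _) (Filter.Eventually.of_forall hf0),
            volume_cball, ← ENNReal.ofReal_mul hKpos.le]
          exact ENNReal.ofReal_le_ofReal (hut p.2).1.2.2.le
      _ = ∫⁻ y in ⋃ p ∈ u, closedBall p.1 p.2, ENNReal.ofReal (f y) :=
          (lintegral_biUnion hucount (fun p _ => isClosed_closedBall.measurableSet) hdisj _).symm
      _ ≤ ∫⁻ y in closedBall c R, ENNReal.ofReal (f y) :=
          lintegral_mono_set (Set.iUnion₂_subset fun p hp => (hut hp).1.2.1)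
      _ = ENNReal.ofReal (∫ y in closedBall c R, f y) :=
          (ofReal_integral_eq_lintegral_ofReal (hfi _ _) (Filter.Eventually.of_forall hf0)).symm
      _ ≤ ENNReal.ofReal A * volume (closedBall c R) := by
          rw [volume_cball, ← ENNReal.ofReal_mul hA.le]
          exact ENNReal.ofReal_le_ofReal (hosc c R hR)
  refine le_trans ?_ hsum
  rw [mul_assoc]
  gcongr
  calc m * volume (badSet b c R (L + K))
      ≤ m * ∑' p : u, volume (badSet b (W p) (5 * p.1.2) L) := by
        gcongr
        exact (measure_mono hcover).trans (measure_biUnion_le _ hucount _)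
    _ = ∑' p : u, m * volume (badSet b (W p) (5 * p.1.2) L) := ENNReal.tsum_mul_left.symm
    _ ≤ _ := by
        refine ENNReal.tsum_le_tsum fun p => ?_
        have hp0 := (hut p.2).1.1
        refine (ih _ _ (by linarith)).trans (le_of_eq ?_)
        rw [volume_cball, volume_cball, vol_ball _ hp0, vol_ball _ (by linarith),
          show 2 * (5 * p.1.2) = 5 * (2 * p.1.2) by ring, mul_pow 5,
          ENNReal.ofReal_mul (by positivity), ENNReal.ofReal_pow (by norm_num)]
        norm_num

open Metric in
lemma bad_decay {n : ℕ} {b : (Fin n → ℝ) → ℝ} (hb : LocallyIntegrable b volume) {A : ℝ}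
    (hA : 0 < A)
    (hosc : ∀ c R, 0 < R → ∫ y in closedBall c R, |b y - avg b (closedBall c R)| ≤
      A * vol (closedBall c R)) (k : ℕ) :
    ∀ c R, 0 < R → 2 ^ k * volume (badSet b c R (k * (2 * 5 ^ n * A))) ≤
      volume (closedBall c R) := by
  induction k with
  | zero =>
    intro c R hR
    simp only [pow_zero, one_mul]
    refine measure_mono ?_
    rintro x ⟨w, r, -, hx, hsub, -⟩
    exact hsub hx
  | succ k ih =>
    intro c R hR
    have := bad_step hb hA hosc (k * (2 * 5 ^ n * A)) (by positivity) (2 ^ k) ih c R hR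
    rw [pow_succ, mul_comm _ (2 : ENNReal)]
    push_cast
    rw [add_mul, one_mul]
    exact this


open Metric in
lemma lower_bound {n : ℕ} {b : (Fin n → ℝ) → ℝ} (hb : LocallyIntegrable b volume)
    (c : Fin n → ℝ) (R : ℝ) (hR : 0 < R) :
    ∀ᵐ x : Fin n → ℝ, x ∈ closedBall c R → ∀ F : ℝ,
      (∀ w r, 0 < r → x ∈ closedBall w r → closedBall w r ⊆ closedBall c R →
        (vol (closedBall w r))⁻¹ * ∫ y in closedBall w r, |b y| ≤ F) → |b x| ≤ F := by
  have hb' : LocallyIntegrable (fun y => |b y|) volume := fun x => by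
    obtain ⟨s, hs, hi⟩ := hb x
    exact ⟨s, hs, hi.abs⟩
  filter_upwards [IsUnifLocDoublingMeasure.ae_tendsto_average volume hb' 1] with x hx hxQ F hF
  have hd : dist x c ≤ R := hxQ
  let w : ℝ → (Fin n → ℝ) := fun r => x + (r / R) • (c - x)
  have hxw : ∀ r, 0 < r → x ∈ closedBall (w r) r := by
    intro r hr
    rw [mem_closedBall, dist_eq_norm]
    have : x - w r = (r / R) • (x - c) := by
      simp only [w]; rw [← neg_sub x c, smul_neg]; abel
    rw [this, norm_smul, ← dist_eq_norm, Real.norm_of_nonneg (by positivity)]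
    calc r / R * dist x c ≤ r / R * R := by gcongr
      _ = r := by field_simp
  have h := hx (l := nhdsWithin (0 : ℝ) (Set.Ioi 0)) w (fun r => r) Filter.tendsto_id
    (by
      filter_upwards [self_mem_nhdsWithin] with r hr
      rw [one_mul]; exact hxw r hr)
  refine le_of_tendsto h ?_
  filter_upwards [self_mem_nhdsWithin, nhdsWithin_le_nhds (Iio_mem_nhds hR)] with r hr hrR
  have hr0 : 0 < r := hr
  have hrR' : r < R := hrR
  have hsub : closedBall (w r) r ⊆ closedBall c R := by
    refine closedBall_subset_closedBall' ?_
    rw [dist_eq_norm]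
    have : w r - c = (1 - r / R) • (x - c) := by
      simp only [w]; rw [← neg_sub x c, smul_neg, sub_smul, one_smul]; abel
    have h1 : 0 ≤ 1 - r / R := by
      rw [sub_nonneg, div_le_one hR]; exact hrR'.le
    rw [this, norm_smul, Real.norm_of_nonneg h1, ← dist_eq_norm]
    have : (1 - r / R) * dist x c ≤ (1 - r / R) * R := by gcongr
    have e : (1 - r / R) * R = R - r := by field_simp
    linarith
  have := hF (w r) r hr0 (hxw r hr0) hsub
  rw [setAverage_eq, smul_eq_mul, measureReal_def]
  exact this

open Metric in
lemma main_bound {n : ℕ} {b : (Fin n → ℝ) → ℝ} (hb : LocallyIntegrable b volume) {A B : ℝ}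
    (hA : 0 < A) (hB : 0 ≤ B)
    (hosc : ∀ c R, 0 < R → ∫ y in closedBall c R, |b y - avg b (closedBall c R)| ≤
      A * vol (closedBall c R)) (hneg : ∀ᵐ x, bneg b x ≤ B) (c : Fin n → ℝ) (R : ℝ) (hR : 0 < R) :
    (vol (closedBall c R))⁻¹ * ∫ y in closedBall c R, |b y - fracMaxLoc 0 (closedBall c R) b y| ≤
      (2 * (2 * 5 ^ n) + 1) * A + 2 * B := by
  set K : ℝ := 2 * 5 ^ n * A with hK
  have hKpos : 0 < K := by positivity
  set M := avg b (closedBall c R) with hM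
  have hv : 0 < vol (closedBall c R) := by rw [vol_ball c hR]; positivity
  have hdec : ∀ k : ℕ, volume (badSet b c R (k * K)) ≤ (2⁻¹) ^ k * volume (closedBall c R) := by
    intro k
    have := bad_decay hb hA hosc k c R hR
    rw [← ENNReal.inv_pow, mul_comm (2 ^ k)⁻¹, ← div_eq_mul_inv, ENNReal.le_div_iff_mul_le (by simp) (by simp),
      mul_comm]
    exact this
  have hnull : ∀ᵐ x : Fin n → ℝ, ∃ k : ℕ, x ∉ badSet b c R (k * K) := by
    rw [ae_iff]
    have hle : ∀ k : ℕ, volume {x : Fin n → ℝ | ¬ ∃ k : ℕ, x ∉ badSet b c R (k * K)} ≤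
        (2⁻¹) ^ k * volume (closedBall c R) := by
      intro k
      refine (measure_mono ?_).trans (hdec k)
      intro x hx
      by_contra hcon
      exact hx ⟨k, hcon⟩
    have htend : Filter.Tendsto (fun k : ℕ => (2⁻¹ : ENNReal) ^ k * volume (closedBall c R))
        Filter.atTop (nhds 0) := by
      have h1 := ENNReal.tendsto_pow_atTop_nhds_zero_of_lt_one
        (r := (2⁻¹ : ENNReal)) (by simp)
      have h2 := ENNReal.Tendsto.mul_const (b := volume (closedBall c R)) h1
        (Or.inr (isCompact_closedBall c R).measure_lt_top.ne)
      simpa using h2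
    exact le_antisymm (ge_of_tendsto' htend hle) zero_le
  let T : ℕ → Set (Fin n → ℝ) := fun k => toMeasurable volume (badSet b c R (k * K))
  have hpt : ∀ᵐ x : Fin n → ℝ, x ∈ closedBall c R →
      ENNReal.ofReal ‖|b x - fracMaxLoc 0 (closedBall c R) b x|‖ ≤
      (ENNReal.ofReal K * ∑' k, (T k).indicator 1 x + ENNReal.ofReal |b x - M|)
        + ENNReal.ofReal (2 * B) := by
    filter_upwards [hnull, hneg, lower_bound hb c R hR] with x hk hBx hlow hxQ
    classical
    let k0 := Nat.find hk
    have hk0 : x ∉ badSet b c R (k0 * K) := Nat.find_spec hk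
    have hmin : ∀ k < k0, x ∈ badSet b c R (k * K) := fun k hk' =>
      not_not.mp (Nat.find_min hk hk')
    set F := fracMaxLoc 0 (closedBall c R) b x with hF
    have hexp : ∀ Q : Set (Fin n → ℝ), (vol Q) ^ ((0:ℝ) / n - 1) = (vol Q)⁻¹ := by
      intro Q
      rw [zero_div, zero_sub, Real.rpow_neg_one]
    have hup : ∀ v ∈ {v : ℝ | ∃ Q : Set (Fin n → ℝ), IsCube Q ∧ x ∈ Q ∧ Q ⊆ closedBall c R ∧
        v = (vol Q) ^ ((0:ℝ) / n - 1) * ∫ y in Q, |b y|}, v ≤ |M| + k0 * K := by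
      rintro v ⟨Q, hQ, hxQ', hsub, rfl⟩
      obtain ⟨w, r, hr, rfl⟩ := (cube_iff Q).1 hQ
      rw [hexp]
      have hvw : 0 < vol (closedBall w r) := by rw [vol_ball w hr]; positivity
      have h1 : ∫ y in closedBall w r, |b y - M| ≤ k0 * K * vol (closedBall w r) := by
        by_contra hcon
        exact hk0 ⟨w, r, hr, hxQ', hsub, not_le.mp hcon⟩
      have hc : IntegrableOn (fun _ : Fin n → ℝ => |M|) (closedBall w r) :=
        integrableOn_const (isCompact_closedBall w r).measure_lt_top.ne
      have h2 : ∫ y in closedBall w r, |b y| ≤ (∫ y in closedBall w r, |b y - M|) +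
          |M| * vol (closedBall w r) := by
        have : ∫ y in closedBall w r, (|b y - M| + |M|) = (∫ y in closedBall w r, |b y - M|) +
            |M| * vol (closedBall w r) := by
          rw [integral_add (intOn_osc hb M w r) hc, setIntegral_const, measureReal_def,
            smul_eq_mul, mul_comm |M|]
          rfl
        rw [← this]
        refine integral_mono (by simpa [IntegrableOn] using intOn_osc hb 0 w r)
          ((intOn_osc hb M w r).add hc) fun y => ?_
        have := abs_add_le (b y - M) M
        simpa using this
      rw [inv_mul_le_iff₀ hvw]
      nlinarith
    have hFle : F ≤ |M| + k0 * K := by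
      refine csSup_le ⟨_, closedBall c R, (cube_iff _).2 ⟨c, R, hR, rfl⟩, hxQ, subset_rfl, rfl⟩ hup
    have hbF : |b x| ≤ F := by
      refine hlow hxQ F fun w r hr hxw hsub => ?_
      refine le_csSup ⟨_, hup⟩ ⟨closedBall w r, (cube_iff _).2 ⟨w, r, hr, rfl⟩, hxw, hsub, ?_⟩
      rw [hexp]
    have hreal : |b x - F| ≤ k0 * K + |b x - M| + 2 * B := by
      have h1 : -(b x) ≤ B := (le_max_left _ _).trans hBx
      have h2 : |M| ≤ |b x| + |b x - M| := by
        have := abs_sub_abs_le_abs_sub M (b x)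
        rw [abs_sub_comm] at this
        linarith
      have h3 : |b x| ≤ b x + 2 * B := by
        rcases abs_cases (b x) with h | h <;> linarith
      have h4 := le_abs_self (b x)
      rw [abs_of_nonpos (by linarith)]
      linarith
    have hcount : (k0 : ENNReal) ≤ ∑' k, (T k).indicator 1 x := by
      calc (k0 : ENNReal) = ∑ k ∈ Finset.range k0, 1 := by simp
        _ = ∑ k ∈ Finset.range k0, (T k).indicator 1 x := by
            refine Finset.sum_congr rfl fun k hk' => ?_
            rw [Set.indicator_of_mem (subset_toMeasurable _ _ (hmin k (Finset.mem_range.1 hk')))]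
            rfl
        _ ≤ _ := ENNReal.sum_le_tsum _
    rw [norm_abs_eq_norm, Real.norm_eq_abs]
    calc ENNReal.ofReal |b x - F| ≤ ENNReal.ofReal (k0 * K + |b x - M| + 2 * B) :=
          ENNReal.ofReal_le_ofReal hreal
      _ = ENNReal.ofReal K * k0 + ENNReal.ofReal |b x - M| + ENNReal.ofReal (2 * B) := by
          rw [ENNReal.ofReal_add (by positivity) (by positivity),
            ENNReal.ofReal_add (by positivity) (by positivity), mul_comm,
            ENNReal.ofReal_mul hKpos.le, ENNReal.ofReal_natCast]
      _ ≤ _ := by gcongr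
  have hTm : ∀ k, Measurable ((T k).indicator (1 : (Fin n → ℝ) → ENNReal)) := fun k =>
    measurable_one.indicator (measurableSet_toMeasurable _ _)
  have hlint : ∫⁻ x in closedBall c R, ENNReal.ofReal ‖|b x - fracMaxLoc 0 (closedBall c R) b x|‖ ≤
      ENNReal.ofReal (((2 * (2 * 5 ^ n) + 1) * A + 2 * B) * vol (closedBall c R)) := by
    calc _ ≤ ∫⁻ x in closedBall c R, ((ENNReal.ofReal K * ∑' k, (T k).indicator 1 x +
            ENNReal.ofReal |b x - M|) + ENNReal.ofReal (2 * B)) :=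
          setLIntegral_mono_ae' isClosed_closedBall.measurableSet hpt
      _ = ENNReal.ofReal K * (∑' k, ∫⁻ x in closedBall c R, (T k).indicator 1 x) +
            (∫⁻ x in closedBall c R, ENNReal.ofReal |b x - M|) +
            ENNReal.ofReal (2 * B) * volume (closedBall c R) := by
          have hm : Measurable fun x => ∑' k, (T k).indicator (1 : (Fin n → ℝ) → ENNReal) x :=
            Measurable.tsum hTm
          rw [lintegral_add_right _ measurable_const, lintegral_add_left (hm.const_mul _),
            lintegral_const_mul _ hm, lintegral_tsum (fun k => (hTm k).aemeasurable),
            setLIntegral_const]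
      _ ≤ ENNReal.ofReal K * (2 * volume (closedBall c R)) +
            ENNReal.ofReal (A * vol (closedBall c R)) +
            ENNReal.ofReal (2 * B) * volume (closedBall c R) := by
          gcongr
          · calc _ ≤ ∑' k : ℕ, (2⁻¹ : ENNReal) ^ k * volume (closedBall c R) := by
                  refine ENNReal.tsum_le_tsum fun k => ?_
                  refine (setLIntegral_le_lintegral _ _).trans ?_
                  rw [lintegral_indicator_one (measurableSet_toMeasurable _ _),
                    measure_toMeasurable]
                  exact hdec k
              _ = _ := by
                  rw [ENNReal.tsum_mul_right, ENNReal.tsum_geometric, ENNReal.one_sub_inv_two,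
                    inv_inv]
          · rw [← ofReal_integral_eq_lintegral_ofReal (intOn_osc hb M c R)
              (Filter.Eventually.of_forall fun y => abs_nonneg _)]
            exact ENNReal.ofReal_le_ofReal (hosc c R hR)
      _ = _ := by
          rw [volume_cball, show (2 : ENNReal) = ENNReal.ofReal 2 by norm_num,
            ← ENNReal.ofReal_mul (by norm_num), ← ENNReal.ofReal_mul hKpos.le,
            ← ENNReal.ofReal_mul (by positivity), ← ENNReal.ofReal_add (by positivity)
            (by positivity), ← ENNReal.ofReal_add (by positivity) (by positivity), hK]
          congr 1
          ring
  have hfin := norm_integral_le_lintegral_norm (μ := volume.restrict (closedBall c R))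
    (fun x => |b x - fracMaxLoc 0 (closedBall c R) b x|)
  have h2 := ENNReal.toReal_mono ENNReal.ofReal_ne_top hlint
  rw [ENNReal.toReal_ofReal (by positivity)] at h2
  rw [inv_mul_le_iff₀ hv, mul_comm (vol _)]
  exact (le_abs_self _).trans (hfin.trans h2)

theorem stmt12 {n : ℕ} (hn : 0 < n) (b : (Fin n → ℝ) → ℝ)
    (hb : MeasureTheory.LocallyIntegrable b volume)
    (hBMO : MemBMO b) (hneg : NegPartBounded b) :
    ∃ C > 0, ∀ Q : Set (Fin n → ℝ), IsCube Q →
      (vol Q)⁻¹ * ∫ y in Q, |b y - fracMaxLoc 0 Q b y| ≤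
        C * (bmoNorm b + negNorm b) := by
  obtain ⟨C0, hC0⟩ := hBMO
  have hbdd : BddAbove {v : ℝ | ∃ Q : Set (Fin n → ℝ), IsCube Q ∧
      v = (vol Q)⁻¹ * ∫ y in Q, |b y - avg b Q|} := by
    refine ⟨C0, ?_⟩
    rintro v ⟨Q, hQ, rfl⟩
    exact hC0 Q hQ
  have hle : ∀ Q : Set (Fin n → ℝ), IsCube Q →
      (vol Q)⁻¹ * ∫ y in Q, |b y - avg b Q| ≤ bmoNorm b := fun Q hQ =>
    le_csSup hbdd ⟨Q, hQ, rfl⟩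
  have hN : 0 ≤ bmoNorm b := by
    refine le_trans ?_ (hle (Metric.closedBall 0 1) ((cube_iff _).2 ⟨0, 1, one_pos, rfl⟩))
    exact mul_nonneg (inv_nonneg.2 ENNReal.toReal_nonneg) (integral_nonneg fun y => abs_nonneg _)
  have hnegle : ∀ᵐ x, bneg b x ≤ negNorm b := by
    obtain ⟨C1, hC1⟩ := hneg
    exact ae_le_essSup ⟨C1, by simpa using hC1⟩
  have hB : 0 ≤ negNorm b := by
    obtain ⟨x, hx⟩ := hnegle.exists
    exact (le_max_right _ _).trans hx
  refine ⟨2 * (2 * 5 ^ n) + 1, by positivity, fun Q hQ => ?_⟩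
  obtain ⟨c, R, hR, rfl⟩ := (cube_iff Q).1 hQ
  have hmain : ∀ ε > 0, (vol (Metric.closedBall c R))⁻¹ *
      ∫ y in Metric.closedBall c R, |b y - fracMaxLoc 0 (Metric.closedBall c R) b y| ≤
      (2 * (2 * 5 ^ n) + 1) * (bmoNorm b + negNorm b) + ε := by
    intro ε hε
    set D : ℝ := 2 * (2 * 5 ^ n) + 1 with hD
    have hDpos : 0 < D := by positivity
    have hD2 : 2 ≤ D := by
      have : (1 : ℝ) ≤ 5 ^ n := one_le_pow₀ (by norm_num)
      linarith
    have hA : 0 < bmoNorm b + ε / D := by positivity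
    have := main_bound hb hA hB (fun c R hR => by
      have hv : 0 < vol (Metric.closedBall c R) := by rw [vol_ball c hR]; positivity
      have h := hle _ ((cube_iff (Metric.closedBall c R)).2 ⟨c, R, hR, rfl⟩)
      rw [inv_mul_le_iff₀ hv] at h
      refine h.trans ?_
      rw [mul_comm]
      gcongr
      have : 0 < ε / D := by positivity
      linarith) hnegle c R hR
    refine this.trans ?_
    rw [← hD, mul_add, mul_add, mul_div_cancel₀ _ hDpos.ne']
    have : 2 * negNorm b ≤ D * negNorm b := by gcongr
    linarith
  exact le_of_forall_pos_le_add hmain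

end
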